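/- Let X be a real Banach space that is either an L₁-predual space or an M-embedded space. Let J be an M-ideal in X and Z a closed subspace of J of finite codimension in J such that Z has property-(HB) in J. Then Z has property-(HB) in X. -/

import Mathlib

open scoped ENNReal

noncomputable section

/-- The annihilator of a subspace `Y` in the continuous dual. -/
def annih {X : Type*} [NormedAddCommGroup X] [NormedSpace ℝ X] (Y : Submodule ℝ X) :
    Submodule ℝ (X →L[ℝ] ℝ) where
  carrier := {f | ∀ y ∈ Y, f y = 0}
  add_mem' := by intro f g hf hg y hy; simp [hf y hy, hg y hy]
  zero_mem' := by intro y hy; simp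
  smul_mem' := by intro c f hf y hy; simp [hf y hy]

/-- `F` is a norm-preserving extension of `f : Y* → ℝ`. -/
def IsNPExtension {X : Type*} [NormedAddCommGroup X] [NormedSpace ℝ X] (Y : Submodule ℝ X)
    (f : Y →L[ℝ] ℝ) (F : X →L[ℝ] ℝ) : Prop :=
  (∀ y : Y, F y = f y) ∧ ‖F‖ = ‖f‖

/-- property-(U) -/
def PropU {X : Type*} [NormedAddCommGroup X] [NormedSpace ℝ X] (Y : Submodule ℝ X) : Prop :=
  ∀ f : Y →L[ℝ] ℝ, ∃! F : X →L[ℝ] ℝ, IsNPExtension Y f F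

/-- property-(wU) -/
def PropwU {X : Type*} [NormedAddCommGroup X] [NormedSpace ℝ X] (Y : Submodule ℝ X) : Prop :=
  ∀ f : Y →L[ℝ] ℝ, (∃ y₀ : Y, ‖y₀‖ = 1 ∧ ‖f‖ = |f y₀|) →
    ∃! F : X →L[ℝ] ℝ, IsNPExtension Y f F

/-- property-(SU) -/
def PropSU {X : Type*} [NormedAddCommGroup X] [NormedSpace ℝ X] (Y : Submodule ℝ X) : Prop :=
  ∃ G : Submodule ℝ (X →L[ℝ] ℝ), IsClosed (G : Set (X →L[ℝ] ℝ)) ∧ IsCompl G (annih Y) ∧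
    ∀ g ∈ G, ∀ h ∈ annih Y, h ≠ 0 → ‖g‖ < ‖g + h‖

/-- property-(HB) -/
def PropHB {X : Type*} [NormedAddCommGroup X] [NormedSpace ℝ X] (Y : Submodule ℝ X) : Prop :=
  ∃ G : Submodule ℝ (X →L[ℝ] ℝ), IsClosed (G : Set (X →L[ℝ] ℝ)) ∧ IsCompl G (annih Y) ∧
    ∀ g ∈ G, ∀ h ∈ annih Y, h ≠ 0 → ‖g‖ < ‖g + h‖ ∧ ‖h‖ ≤ ‖g + h‖

/-- M-ideal -/
def MIdeal {X : Type*} [NormedAddCommGroup X] [NormedSpace ℝ X] (Y : Submodule ℝ X) : Prop :=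
  ∃ G : Submodule ℝ (X →L[ℝ] ℝ), IsClosed (G : Set (X →L[ℝ] ℝ)) ∧ IsCompl G (annih Y) ∧
    ∀ g ∈ G, ∀ h ∈ annih Y, ‖g + h‖ = ‖g‖ + ‖h‖



universe u v

/-- A Banach space is an `L₁`-predual if its dual is isometric to `L₁(μ)` for some measure. -/
def IsL1Predual (E : Type u) [NormedAddCommGroup E] [NormedSpace ℝ E] : Prop :=
  ∃ (Ω : Type v) (_ : MeasurableSpace Ω) (μ : MeasureTheory.Measure Ω),
    Nonempty ((E →L[ℝ] ℝ) ≃ₗᵢ[ℝ] MeasureTheory.Lp ℝ 1 μ)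

/-- The canonical image of `E` in its bidual, as a submodule. -/
def canonicalImage (E : Type u) [NormedAddCommGroup E] [NormedSpace ℝ E] :
    Submodule ℝ (StrongDual ℝ (StrongDual ℝ E)) :=
  LinearMap.range (NormedSpace.inclusionInDoubleDual ℝ E).toLinearMap

/-- A Banach space is `M`-embedded if its canonical image in the bidual is an M-ideal. -/
def IsMEmbedded (E : Type u) [NormedAddCommGroup E] [NormedSpace ℝ E] : Prop :=
  MIdeal (X := StrongDual ℝ (StrongDual ℝ E)) (canonicalImage E)

theorem stmt6 {X : Type u} [NormedAddCommGroup X] [NormedSpace ℝ X] [CompleteSpace X]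
    (hX : IsL1Predual.{u, v} X ∨ IsMEmbedded X)
    (J : Submodule ℝ X) (hJc : IsClosed (J : Set X)) (hJ : MIdeal J)
    (Z : Submodule ℝ X) (hZJ : Z ≤ J) (hZ : IsClosed (Z : Set X))
    [FiniteDimensional ℝ (↥J ⧸ Z.comap J.subtype)]
    (hHB : PropHB (Z.comap J.subtype)) :
    PropHB Z := by
  obtain ⟨M, hMc, hM, hMn⟩ := hJ
  obtain ⟨G, hGc, hG, hGn⟩ := hHB
  let R : (X →L[ℝ] ℝ) →L[ℝ] (J →L[ℝ] ℝ) := ContinuousLinearMap.precomp ℝ J.subtypeL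
  have hR : ∀ (f : X →L[ℝ] ℝ) (j : J), R f j = f j := fun f j => rfl
  have hR0 : ∀ f : X →L[ℝ] ℝ, R f = 0 → f ∈ annih J := by
    intro f hf y hy
    have := hR f ⟨y, hy⟩
    rw [hf] at this
    exact this.symm
  have hA0 : ∀ f ∈ annih J, R f = 0 := by
    intro f hf
    ext j
    exact hf j j.2
  have hRZ : ∀ f : X →L[ℝ] ℝ, R f ∈ annih (Z.comap J.subtype) ↔ f ∈ annih Z := by
    intro f
    constructor
    · intro hf z hz
      exact hf ⟨z, hZJ hz⟩ hz
    · intro hf z hz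
      exact hf z hz
  have hdec : ∀ f : X →L[ℝ] ℝ, ∃ m ∈ M, ∃ k ∈ annih J, m + k = f := by
    intro f
    have : f ∈ M ⊔ annih J := by rw [hM.sup_eq_top]; trivial
    exact Submodule.mem_sup.1 this
  have hiso : ∀ f ∈ M, ‖R f‖ = ‖f‖ := by
    intro f hf
    obtain ⟨F, hF, hFn⟩ := exists_extension_norm_eq J (R f)
    have h1 : F - f ∈ annih J := by
      intro y hy
      have := hF ⟨y, hy⟩
      simp only [hR] at this
      simp [this]
    have h2 := hMn f hf _ h1
    rw [add_sub_cancel] at h2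
    have h3 : ‖R f‖ ≤ ‖f‖ := by
      refine ContinuousLinearMap.opNorm_le_bound _ (norm_nonneg _) ?_
      intro j
      exact f.le_opNorm j
    have := norm_nonneg (F - f)
    linarith
  have hsurj : ∀ g : J →L[ℝ] ℝ, ∃ m ∈ M, R m = g := by
    intro g
    obtain ⟨F, hF, -⟩ := exists_extension_norm_eq J g
    obtain ⟨m, hm, k, hk, rfl⟩ := hdec F
    refine ⟨m, hm, ?_⟩
    ext j
    have h1 := hF j
    have h2 := hk j j.2
    simp [h2] at h1
    rw [hR, h1]
  refine ⟨M ⊓ G.comap R.toLinearMap, ?_, ?_, ?_⟩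
  · exact hMc.inter (hGc.preimage R.continuous)
  · constructor
    · rw [Submodule.disjoint_def]
      rintro f ⟨hfM, hfG⟩ hfZ
      have h1 : R f = 0 := (Submodule.disjoint_def.1 hG.disjoint) _ hfG ((hRZ f).2 hfZ)
      exact (Submodule.disjoint_def.1 hM.disjoint) _ hfM (hR0 f h1)
    · rw [codisjoint_iff, eq_top_iff]
      intro f _
      have : R f ∈ G ⊔ annih (Z.comap J.subtype) := by rw [hG.sup_eq_top]; trivial
      obtain ⟨g, hg, h, hh, hgh⟩ := Submodule.mem_sup.1 this
      obtain ⟨m, hm, rfl⟩ := hsurj g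
      refine Submodule.mem_sup.2 ⟨m, ⟨hm, hg⟩, f - m, ?_, by abel⟩
      rw [← hRZ, map_sub, ← hgh, add_sub_cancel_left]
      exact hh
  · rintro g ⟨hgM, hgG⟩ h hh h0
    obtain ⟨m, hm, k, hk, rfl⟩ := hdec h
    have hmZ : R m ∈ annih (Z.comap J.subtype) := by
      have := (hRZ _).2 hh
      rwa [map_add, hA0 k hk, add_zero] at this
    have e1 : ‖g + (m + k)‖ = ‖g + m‖ + ‖k‖ := by
      rw [← add_assoc]
      exact hMn _ (M.add_mem hgM hm) _ hk
    rw [e1, hMn m hm k hk]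
    by_cases hm0 : m = 0
    · subst hm0
      have hk0 : 0 < ‖k‖ := by
        rw [norm_pos_iff]
        simpa using h0
      have := norm_nonneg g
      simp only [add_zero, norm_zero, zero_add]
      constructor <;> linarith
    · have hRm : R m ≠ 0 := by
        intro h
        exact hm0 ((Submodule.disjoint_def.1 hM.disjoint) _ hm (hR0 m h))
      have h1 := hGn (R g) hgG (R m) hmZ hRm
      rw [← map_add, hiso _ hgM, hiso _ hm, hiso _ (M.add_mem hgM hm)] at h1
      have := norm_nonneg k
      constructor <;> linarith [h1.1, h1.2]

end
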